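/- arXiv:0909.4062 — 6 statements merged into one kernel-verified Lean document; each statement's English description precedes it below -/
import Mathlib

section
/- Let λ ∈ (1,2) and μ > 0 be real numbers and set q = μ/(λ−1). For every x ∈ (0,q) there exist a sequence ε : ℕ → {0,1} and a sequence (x_n) of reals with x₀ = x and x_{n+1} = λ·x_n − ε_n·μ for all n ∈ ℕ, such that x_n ∈ (0,q) for every n ∈ ℕ. -/
/-- Every point of `(0, q)` has a branch that maps it back into `(0, q)`. -/
theorem exists_branch_mem_Ioo {lam mu q y : ℝ} (hlam1 : 1 < lam) (hlam2 : lam < 2)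
    (hmu : 0 < mu) (hq : q * (lam - 1) = mu) (hy : y ∈ Set.Ioo (0 : ℝ) q) :
    ∃ e : ℝ, (e = 0 ∨ e = 1) ∧ lam * y - e * mu ∈ Set.Ioo (0 : ℝ) q := by
  obtain ⟨hy0, hyq⟩ := hy
  by_cases h : lam * y < q
  · exact ⟨0, Or.inl rfl, by nlinarith, by linarith⟩
  · exact ⟨1, Or.inr rfl, by nlinarith, by nlinarith⟩

/-- One-dimensional content of the superposition property of the prototypical
blender-horseshoe of Bonatti–Díaz: for every point `x` of the interval `(0, q)`,
`q = μ/(λ−1)`, there is a choice of branches (`x ↦ λx` or `x ↦ λx − μ`) whose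
forward orbit starting at `x` stays in `(0, q)` forever. -/
theorem blender_central_superposition (lam mu q : ℝ)
    (hlam1 : 1 < lam) (hlam2 : lam < 2) (hmu : 0 < mu)
    (hq : q = mu / (lam - 1)) :
    ∀ x ∈ Set.Ioo (0 : ℝ) q,
      ∃ (eps : ℕ → ℝ) (xs : ℕ → ℝ),
        (∀ n, eps n = 0 ∨ eps n = 1) ∧
        xs 0 = x ∧
        (∀ n, xs (n + 1) = lam * xs n - eps n * mu) ∧
        (∀ n, xs n ∈ Set.Ioo (0 : ℝ) q) := by
  intro x hx
  have hq' : q * (lam - 1) = mu := by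
    rw [hq, div_mul_cancel₀ _ (sub_pos.mpr hlam1).ne']
  choose! e he hmem using fun y (hy : y ∈ Set.Ioo (0 : ℝ) q) =>
    exists_branch_mem_Ioo hlam1 hlam2 hmu hq' hy
  let xs : ℕ → ℝ := fun n => (fun y => lam * y - e y * mu)^[n] x
  have hsucc : ∀ n, xs (n + 1) = lam * xs n - e (xs n) * mu := fun n =>
    Function.iterate_succ_apply' _ n x
  have hxs : ∀ n, xs n ∈ Set.Ioo (0 : ℝ) q := by
    intro n
    induction n with
    | zero => exact hx
    | succ n ih => exact hsucc n ▸ hmem _ ih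
  exact ⟨fun n => e (xs n), xs, fun n => he _ (hxs n), rfl, hsucc, hxs⟩
end

section
/- Let λ ∈ (1,2) and μ > 0 be real numbers and set q = μ/(λ−1). There exists η > 0 with the following property. Let g₀, g₁ : [0,q] → ℝ be continuous strictly increasing functions such that |g₀(x) − λx| ≤ η and |g₁(x) − (λx − μ)| ≤ η for all x ∈ [0,q], and let p', q' ∈ [0,q] satisfy g₀(p') = p' and g₁(q') = q'. Then p' < q', and for every x ∈ (p', q') one has g₀(x) ∈ (p', q') or g₁(x) ∈ (p', q'). -/
/-- One-dimensional robust version of the covering condition BH6 of a blender-horseshoe: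
the covering property of the central dynamics `x ↦ λx`, `x ↦ λx − μ` persists for
uniformly C⁰-close continuous strictly increasing maps, with the interval between the
continuations `p'`, `q'` of the reference fixed points playing the role of `(0, q)`,
`q = μ/(λ−1)`. -/
theorem blender_central_covering_robust (lam mu q : ℝ)
    (hlam1 : 1 < lam) (hlam2 : lam < 2) (hmu : 0 < mu)
    (hq : q = mu / (lam - 1)) :
    ∃ η > (0 : ℝ), ∀ g₀ g₁ : ℝ → ℝ,
      ContinuousOn g₀ (Set.Icc 0 q) → ContinuousOn g₁ (Set.Icc 0 q) →
      StrictMonoOn g₀ (Set.Icc 0 q) → StrictMonoOn g₁ (Set.Icc 0 q) →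
      (∀ x ∈ Set.Icc (0 : ℝ) q, |g₀ x - lam * x| ≤ η) →
      (∀ x ∈ Set.Icc (0 : ℝ) q, |g₁ x - (lam * x - mu)| ≤ η) →
      ∀ p' q' : ℝ, p' ∈ Set.Icc (0 : ℝ) q → q' ∈ Set.Icc (0 : ℝ) q →
        g₀ p' = p' → g₁ q' = q' →
        p' < q' ∧
        ∀ x ∈ Set.Ioo p' q', g₀ x ∈ Set.Ioo p' q' ∨ g₁ x ∈ Set.Ioo p' q' := by
  have hlam : 0 < lam - 1 := by linarith
  have hgap : 0 < mu * (2 - lam) := mul_pos hmu (by linarith)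
  refine ⟨mu * (2 - lam) / (4 * lam), by positivity, ?_⟩
  set η := mu * (2 - lam) / (4 * lam) with hη
  have hηlam : 4 * (η * lam) = mu * (2 - lam) := by
    rw [hη]
    field_simp
  have hηmu : 2 * η < mu := by nlinarith
  intro g₀ g₁ _ _ hmono₀ hmono₁ hclose₀ hclose₁ p' q' hp hq' hfix₀ hfix₁
  -- The fixed points satisfy `(lam - 1) p' ≤ η` and `(lam - 1) q' ≥ mu - η`.
  have hp_le := (abs_le.1 (hclose₀ p' hp)).1
  have hq_ge := (abs_le.1 (hclose₁ q' hq')).2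
  rw [hfix₀] at hp_le
  rw [hfix₁] at hq_ge
  refine ⟨by nlinarith, fun x hx => ?_⟩
  have hxmem : x ∈ Set.Icc (0 : ℝ) q := ⟨hp.1.trans hx.1.le, hx.2.le.trans hq'.2⟩
  have hgt := hmono₀ hp hxmem hx.1
  have hlt := hmono₁ hxmem hq' hx.2
  rw [hfix₀] at hgt
  rw [hfix₁] at hlt
  by_contra! hnot
  have hge : q' ≤ g₀ x := not_lt.1 fun h => hnot.1 ⟨hgt, h⟩
  have hle : g₁ x ≤ p' := not_lt.1 fun h => hnot.2 ⟨h, hlt⟩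
  have hx₀ := (abs_le.1 (hclose₀ x hxmem)).2
  have hx₁ := (abs_le.1 (hclose₁ x hxmem)).1
  have hwidth : q' - p' ≤ mu + 2 * η := by linarith
  nlinarith [mul_le_mul_of_nonneg_left hwidth hlam.le]
end

section
/- Let λ ∈ (1,2) and μ > 0 be real numbers and set q = μ/(λ−1). There exists η > 0 with the following property. Let g₀, g₁ : [0,q] → ℝ be continuous strictly increasing functions such that |g₀(x) − λx| ≤ η and |g₁(x) − (λx − μ)| ≤ η for all x ∈ [0,q], and let p', q' ∈ [0,q] satisfy g₀(p') = p' and g₁(q') = q'. Then p' < q', and for every x ∈ (p', q') there exist a sequence ε : ℕ → {0,1} and a sequence (x_n) with x₀ = x and x_{n+1} = g_{ε_n}(x_n) for all n ∈ ℕ, such that x_n ∈ (p', q') for every n ∈ ℕ. -/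
/-- If every point of `S` is sent back into `S` by one of two maps, then every point of `S` has
an itinerary whose orbit stays in `S`. -/
theorem exists_itinerary_mem_of_forall_mem_or_mem {α : Type*} {S : Set α} {f g : α → α}
    (h : ∀ x ∈ S, f x ∈ S ∨ g x ∈ S) {x : α} (hx : x ∈ S) :
    ∃ (eps : ℕ → Fin 2) (xs : ℕ → α), xs 0 = x ∧
      (∀ n, xs (n + 1) = (if eps n = 0 then f else g) (xs n)) ∧ ∀ n, xs n ∈ S := by
  have step : ∀ y : S, ∃ e : Fin 2, (if e = 0 then f else g) y ∈ S := fun y =>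
    (h y y.2).elim (fun hy => ⟨0, by simpa using hy⟩) (fun hy => ⟨1, by simpa using hy⟩)
  choose e he using step
  let orbit : ℕ → S := fun n => Nat.rec ⟨x, hx⟩ (fun _ y => ⟨_, he y⟩) n
  exact ⟨fun n => e (orbit n), fun n => (orbit n).1, rfl, fun _ => rfl, fun n => (orbit n).2⟩


/-- One-dimensional robust version of the superposition property of a blender-horseshoe:
for uniformly C⁰-close continuous strictly increasing perturbations `g₀`, `g₁` of the
central dynamics `x ↦ λx`, `x ↦ λx − μ`, every point between the continuations `p'`, `q'`
of the reference fixed points admits an itinerary whose forward orbit stays between them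
forever. -/
theorem blender_central_superposition_robust (lam mu q : ℝ)
    (hlam1 : 1 < lam) (hlam2 : lam < 2) (hmu : 0 < mu)
    (hq : q = mu / (lam - 1)) :
    ∃ η > (0 : ℝ), ∀ g₀ g₁ : ℝ → ℝ,
      ContinuousOn g₀ (Set.Icc 0 q) → ContinuousOn g₁ (Set.Icc 0 q) →
      StrictMonoOn g₀ (Set.Icc 0 q) → StrictMonoOn g₁ (Set.Icc 0 q) →
      (∀ x ∈ Set.Icc (0 : ℝ) q, |g₀ x - lam * x| ≤ η) →
      (∀ x ∈ Set.Icc (0 : ℝ) q, |g₁ x - (lam * x - mu)| ≤ η) →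
      ∀ p' q' : ℝ, p' ∈ Set.Icc (0 : ℝ) q → q' ∈ Set.Icc (0 : ℝ) q →
        g₀ p' = p' → g₁ q' = q' →
        p' < q' ∧
        ∀ x ∈ Set.Ioo p' q',
          ∃ (eps : ℕ → Fin 2) (xs : ℕ → ℝ),
            xs 0 = x ∧
            (∀ n, xs (n + 1) = (if eps n = 0 then g₀ else g₁) (xs n)) ∧
            (∀ n, xs n ∈ Set.Ioo p' q') := by
  have hk : 0 < lam - 1 := by linarith
  have hq0 : 0 < q := hq ▸ div_pos hmu hk
  have hmuq : mu = q * (lam - 1) := by rw [hq, div_mul_cancel₀ _ hk.ne']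
  -- `d` bounds the displacement of the fixed points.
  obtain ⟨d, hd⟩ : ∃ d, d = q * (2 - lam) / 8 := ⟨_, rfl⟩
  have hd0 : 0 < d := by
    rw [hd]
    exact div_pos (mul_pos hq0 (by linarith)) (by norm_num)
  have hdk : d * (lam - 1) < d := by nlinarith
  have hqmu : q - mu = 8 * d := by rw [hd, hmuq]; ring
  refine ⟨d * (lam - 1), mul_pos hd0 hk, ?_⟩
  intro g₀ g₁ _ _ hm₀ hm₁ h₀ h₁ p' q' hp' hq' hfp hfq
  have hpd : p' ≤ d := by
    have h := (abs_le.mp (h₀ p' hp')).1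
    rw [hfp] at h
    exact le_of_mul_le_mul_right (by linarith) hk
  have hqd : q - d ≤ q' := by
    have h := (abs_le.mp (h₁ q' hq')).2
    rw [hfq] at h
    exact le_of_mul_le_mul_right (by linarith) hk
  refine ⟨by linarith, fun x hx => exists_itinerary_mem_of_forall_mem_or_mem ?_ hx⟩
  intro y hy
  have hyI : y ∈ Set.Icc 0 q := ⟨hp'.1.trans hy.1.le, hy.2.le.trans hq'.2⟩
  rcases lt_or_ge (g₀ y) q' with hlt | hge
  · exact Or.inl ⟨hfp ▸ hm₀ hp' hyI hy.1, hlt⟩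
  · refine Or.inr ⟨?_, (hm₁ hyI hq' hy.2).trans_eq hfq⟩
    have hu := (abs_le.mp (h₀ y hyI)).2
    have hl := (abs_le.mp (h₁ y hyI)).1
    linarith
end

section
/- With E, A and the cones as in the context: for every α > 0 and every v = (v_s, v_c, v_u) ∈ C^s_α one has max(λ⁻¹|v_c|, ‖U⁻¹ v_u‖) ≤ (α/(2λ))·‖S⁻¹ v_s‖. In particular A⁻¹ v ∈ C^s_{α/(2λ)}, and since λ > 1 one has α/(2λ) < α, so the stable cone field C^s_α is strictly invariant under A⁻¹. -/
/-- Strict invariance of the stable cone field under the inverse of the derivative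
`A(v_s, v_c, v_u) = (S v_s, λ v_c, U v_u)` of the prototypical blender-horseshoe
(part of condition BH2): every `v ∈ C^s_α` satisfies
`max(λ⁻¹|v_c|, ‖U⁻¹ v_u‖) ≤ (α/(2λ))·‖S⁻¹ v_s‖`, so `A⁻¹ v ∈ C^s_{α/(2λ)} ⊆ C^s_α`
since `α/(2λ) < α`. -/
theorem blender_s_cone_invariance (s u : ℕ) (hs : 1 ≤ s) (hu : 1 ≤ u)
    (lam : ℝ) (hlam1 : 1 < lam) (hlam2 : lam < 2)
    (S : EuclideanSpace ℝ (Fin s) ≃L[ℝ] EuclideanSpace ℝ (Fin s))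
    (U : EuclideanSpace ℝ (Fin u) ≃L[ℝ] EuclideanSpace ℝ (Fin u))
    (hS : ‖(S : EuclideanSpace ℝ (Fin s) →L[ℝ] EuclideanSpace ℝ (Fin s))‖ ≤ 1 / 2)
    (hU : ‖(U.symm : EuclideanSpace ℝ (Fin u) →L[ℝ] EuclideanSpace ℝ (Fin u))‖ ≤ 1 / 2)
    (α : ℝ) (hα : 0 < α)
    (vs : EuclideanSpace ℝ (Fin s)) (vc : ℝ) (vu : EuclideanSpace ℝ (Fin u))
    (hv : max |vc| ‖vu‖ ≤ α * ‖vs‖) :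
    max (lam⁻¹ * |vc|) ‖U.symm vu‖ ≤ (α / (2 * lam)) * ‖S.symm vs‖ ∧
    α / (2 * lam) < α := by
  have hlam : 0 < lam := by linarith
  have hvs : ‖vs‖ ≤ 1 / 2 * ‖S.symm vs‖ := by
    simpa using
      (S : EuclideanSpace ℝ (Fin s) →L[ℝ] EuclideanSpace ℝ (Fin s)).le_of_opNorm_le hS (S.symm vs)
  have hvu : ‖U.symm vu‖ ≤ 1 / 2 * ‖vu‖ :=
    (U.symm : EuclideanSpace ℝ (Fin u) →L[ℝ] EuclideanSpace ℝ (Fin u)).le_of_opNorm_le hU vu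
  obtain ⟨hc, hu'⟩ := max_le_iff.mp hv
  refine ⟨max_le ?_ ?_, div_lt_self hα (by linarith)⟩
  · calc lam⁻¹ * |vc| ≤ lam⁻¹ * (α * (1 / 2 * ‖S.symm vs‖)) := by
          gcongr
          exact hc.trans (by gcongr)
      _ = α / (2 * lam) * ‖S.symm vs‖ := by field_simp
  · calc ‖U.symm vu‖ ≤ 1 / 2 * (α * (1 / 2 * ‖S.symm vs‖)) := by
          refine hvu.trans ?_
          gcongr
          exact hu'.trans (by gcongr)
      _ = α / (2 * 2) * ‖S.symm vs‖ := by ring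
      _ ≤ α / (2 * lam) * ‖S.symm vs‖ := by gcongr
end

section
/- Let λ ∈ (1,2) and μ > 0 be real numbers and set q = μ/(λ−1). Let c : [0,1] → ℝ be continuous with c(0) = c(1) = 0 and c(t) ∈ (0,q) for all t ∈ (0,1). Then either (a) λ·c(t) ∈ (0,q) for all t ∈ (0,1), or (b) there exist t₂, t₃ with 0 < t₂ < t₃ < 1 such that λ·c(t₂) = μ, λ·c(t₃) = μ, and λ·c(t) − μ ∈ (0,q) for all t ∈ (t₂, t₃). -/
/-- A continuous function that is below `m` at `a` and above `m` at `b` has a last crossing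
of the level `m` in `(a, b)`. -/
theorem exists_last_crossing {f : ℝ → ℝ} {a b m : ℝ} (hab : a ≤ b)
    (hf : ContinuousOn f (Set.Icc a b)) (ha : f a < m) (hb : m < f b) :
    ∃ s ∈ Set.Ioo a b, f s = m ∧ ∀ x ∈ Set.Ioc s b, m < f x := by
  have hcomp : IsCompact (Set.Icc a b ∩ f ⁻¹' {m}) :=
    isCompact_Icc.of_isClosed_subset
      (hf.preimage_isClosed_of_isClosed isClosed_Icc isClosed_singleton) Set.inter_subset_left
  have hne : (Set.Icc a b ∩ f ⁻¹' {m}).Nonempty := by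
    obtain ⟨x, hx, hxm⟩ := intermediate_value_Icc hab hf ⟨ha.le, hb.le⟩
    exact ⟨x, hx, hxm⟩
  obtain ⟨s, ⟨hs, hsm⟩, hmax⟩ := hcomp.exists_isGreatest hne
  have hsm : f s = m := hsm
  refine ⟨s, ⟨lt_of_le_of_ne hs.1 ?_, lt_of_le_of_ne hs.2 ?_⟩, hsm, fun x hx => ?_⟩
  · rintro rfl
    exact ha.ne hsm
  · rintro rfl
    exact hb.ne' hsm
  · by_contra! hxm
    have hax : a ≤ x := hs.1.trans hx.1.le
    obtain ⟨y, hy, hym⟩ := intermediate_value_Icc hx.2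
      (hf.mono (Set.Icc_subset_Icc_left hax)) ⟨hxm, hb.le⟩
    have hys : y ≤ s := hmax ⟨⟨hax.trans hy.1, hy.2⟩, hym⟩
    linarith [hx.1, hy.1]

/-- A continuous function that is above `m` at `a` and below `m` at `b` has a first crossing
of the level `m` in `(a, b)`. -/
theorem exists_first_crossing {f : ℝ → ℝ} {a b m : ℝ} (hab : a ≤ b)
    (hf : ContinuousOn f (Set.Icc a b)) (ha : m < f a) (hb : f b < m) :
    ∃ s ∈ Set.Ioo a b, f s = m ∧ ∀ x ∈ Set.Ico a s, m < f x := by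
  have hg : ContinuousOn (fun x => f (-x)) (Set.Icc (-b) (-a)) :=
    hf.comp continuous_neg.continuousOn
      fun x hx => ⟨by linarith [hx.2], by linarith [hx.1]⟩
  obtain ⟨s, hs, hsm, hlt⟩ := exists_last_crossing (m := m) (neg_le_neg hab) hg
    (by simpa using hb) (by simpa using ha)
  refine ⟨-s, ⟨by linarith [hs.2], by linarith [hs.1]⟩, hsm, fun x hx => ?_⟩
  simpa using hlt (-x) ⟨by linarith [hx.2], by linarith [hx.1]⟩


/-- Central-coordinate content of Lemma 4.4 of Bonatti–Díaz (the image of a folding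
manifold contains a folding manifold): if `c : [0,1] → ℝ` is the central coordinate of a
folding manifold relative to `P` (i.e. `c(0) = c(1) = 0` and `c(t) ∈ (0,q)` for
`t ∈ (0,1)`, where `q = μ/(λ−1)`), then either the branch `x ↦ λx` keeps all interior
disks in between (case (a)), or there are parameters `0 < t₂ < t₃ < 1` with
`λ c(t₂) = λ c(t₃) = μ` such that the branch `x ↦ λx − μ` puts all disks with
`t ∈ (t₂,t₃)` in between (case (b)). -/
theorem blender_folding_image (lam mu q : ℝ)
    (hlam1 : 1 < lam) (hlam2 : lam < 2) (hmu : 0 < mu)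
    (hq : q = mu / (lam - 1))
    (c : ℝ → ℝ) (hc : ContinuousOn c (Set.Icc 0 1))
    (hc0 : c 0 = 0) (hc1 : c 1 = 0)
    (hcin : ∀ t ∈ Set.Ioo (0 : ℝ) 1, c t ∈ Set.Ioo (0 : ℝ) q) :
    (∀ t ∈ Set.Ioo (0 : ℝ) 1, lam * c t ∈ Set.Ioo (0 : ℝ) q) ∨
    (∃ t₂ t₃ : ℝ, 0 < t₂ ∧ t₂ < t₃ ∧ t₃ < 1 ∧
      lam * c t₂ = mu ∧ lam * c t₃ = mu ∧
      ∀ t ∈ Set.Ioo t₂ t₃, lam * c t - mu ∈ Set.Ioo (0 : ℝ) q) := by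
  have hlam0 : 0 < lam := by linarith
  have hq' : lam * q - mu = q := by
    have : lam - 1 ≠ 0 := by linarith
    rw [hq]
    field_simp
    ring
  have hmuq : mu < q := by
    rw [hq, lt_div_iff₀ (by linarith)]
    nlinarith
  by_cases h : ∀ t ∈ Set.Ioo (0 : ℝ) 1, lam * c t < q
  · exact Or.inl fun t ht => ⟨mul_pos hlam0 (hcin t ht).1, h t ht⟩
  · right
    push Not at h
    obtain ⟨t, ht, hqt⟩ := h
    have hf : ContinuousOn (fun x => lam * c x) (Set.Icc 0 1) := continuousOn_const.mul hc
    obtain ⟨r, hr, hrm, hr_gt⟩ := exists_last_crossing (m := mu) ht.1.le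
      (hf.mono (Set.Icc_subset_Icc_right ht.2.le)) (by simpa [hc0] using hmu)
      (hmuq.trans_le hqt)
    obtain ⟨s, hs, hsm, hs_gt⟩ := exists_first_crossing (m := mu) ht.2.le
      (hf.mono (Set.Icc_subset_Icc_left ht.1.le)) (hmuq.trans_le hqt)
      (by simpa [hc1] using hmu)
    refine ⟨r, s, hr.1, hr.2.trans hs.1, hs.2, hrm, hsm, fun x hx => ⟨?_, ?_⟩⟩
    · rw [sub_pos]
      rcases le_total x t with hxt | hxt
      · exact hr_gt x ⟨hx.1, hxt⟩
      · exact hs_gt x ⟨hxt, hx.2⟩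
    · have hxq := (hcin x ⟨hr.1.trans hx.1, hx.2.trans hs.2⟩).2
      linarith [mul_lt_mul_of_pos_left hxq hlam0]
end

section
/- Let (X, d) be a metric space and f : X → X a continuous map. Let x, r, w, p ∈ X. Suppose: (i) there are a sequence (y_k) in X and a sequence (n_k) in ℕ such that f^{n_k}(y_k) = x for every k and y_k → r; (ii) there is a sequence (m_j) in ℕ such that f^{m_j}(x) → w; and (iii) p is chain-attainable from w. Then p is chain-attainable from r. -/
/-- `b` is chain-attainable from `a` for the map `f`: for every `ε > 0` there is an
ε-pseudo-orbit from `a` to `b`, i.e. a finite sequence `z 0 = a, …, z N = b` with `N ≥ 1`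
and `dist (f (z i)) (z (i+1)) < ε` for all `0 ≤ i < N`. -/
def ChainAttainable {X : Type*} [MetricSpace X] (f : X → X) (a b : X) : Prop :=
  ∀ ε > (0 : ℝ), ∃ (N : ℕ) (z : ℕ → X),
    1 ≤ N ∧ z 0 = a ∧ z N = b ∧ ∀ i < N, dist (f (z i)) (z (i + 1)) < ε

/-- There is an `ε`-pseudo-orbit of `f` from `a` to `b`. -/
def HasPseudoOrbit {X : Type*} [MetricSpace X] (f : X → X) (ε : ℝ) (a b : X) : Prop :=
  ∃ (N : ℕ) (z : ℕ → X),
    1 ≤ N ∧ z 0 = a ∧ z N = b ∧ ∀ i < N, dist (f (z i)) (z (i + 1)) < ε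

namespace HasPseudoOrbit

variable {X : Type*} [MetricSpace X] {f : X → X} {ε δ : ℝ} {a a' b : X}

/-- Moving the starting point of a pseudo-orbit increases its error by at most the
displacement of the image of the starting point. -/
theorem change_start (h : HasPseudoOrbit f ε a b) (hδ : dist (f a') (f a) < δ) :
    HasPseudoOrbit f (δ + ε) a' b := by
  obtain ⟨N, z, hN, rfl, hb, hz⟩ := h
  refine ⟨N, Function.update z 0 a', hN, by simp, ?_, fun i hi => ?_⟩
  · rwa [Function.update_of_ne (by omega)]
  · rw [Function.update_of_ne i.succ_ne_zero]
    rcases eq_or_ne i 0 with rfl | hi0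
    · rw [Function.update_self]
      exact (dist_triangle _ _ _).trans_lt (add_lt_add hδ (hz 0 hi))
    · rw [Function.update_of_ne hi0]
      linarith [hz i hi, dist_nonneg.trans_lt hδ]

theorem of_map (hε : 0 < ε) (h : HasPseudoOrbit f ε (f a) b) : HasPseudoOrbit f ε a b := by
  obtain ⟨N, z, -, h0, hb, hz⟩ := h
  refine ⟨N + 1, fun i => Nat.casesOn i a z, by omega, rfl, hb, fun i hi => ?_⟩
  cases i with
  | zero => simpa [h0] using hε
  | succ i => exact hz i (by omega)

theorem of_iterate (hε : 0 < ε) (n : ℕ) (h : HasPseudoOrbit f ε (f^[n] a) b) :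
    HasPseudoOrbit f ε a b := by
  induction n with
  | zero => exact h
  | succ n ih =>
    rw [Function.iterate_succ_apply'] at h
    exact ih (h.of_map hε)

end HasPseudoOrbit

/-- Pseudo-orbit concatenation argument proving Lemma 5.5: if backward iterates of `x`
accumulate on `r` (there are preimages `y k` of `x` with `y k → r`), forward iterates of
`x` accumulate on `w`, and `p` is chain-attainable from `w`, then `p` is chain-attainable
from `r`. -/
theorem chainAttainable_of_accumulation {X : Type*} [MetricSpace X]
    (f : X → X) (hf : Continuous f) (x r w p : X)
    (h1 : ∃ (y : ℕ → X) (n : ℕ → ℕ),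
      (∀ k, f^[n k] (y k) = x) ∧ Filter.Tendsto y Filter.atTop (nhds r))
    (h2 : ∃ m : ℕ → ℕ, Filter.Tendsto (fun j => f^[m j] x) Filter.atTop (nhds w))
    (h3 : ChainAttainable f w p) :
    ChainAttainable f r p := by
  obtain ⟨y, n, hyx, hyr⟩ := h1
  obtain ⟨m, hm⟩ := h2
  intro ε hε
  have h_image_close : ∀ {u : ℕ → X} {a : X}, Filter.Tendsto u Filter.atTop (nhds a) →
      ∃ k, dist (f (u k)) (f a) < ε / 3 := fun hu =>
    (Metric.tendsto_nhds.1 ((hf.tendsto _).comp hu) (ε / 3) (by positivity)).exists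
  obtain ⟨j, hj⟩ := h_image_close hm
  obtain ⟨k, hk⟩ := h_image_close hyr
  have hw : HasPseudoOrbit f (ε / 3) w p := h3 (ε / 3) (by positivity)
  have hx : HasPseudoOrbit f (ε / 3 + ε / 3) x p :=
    (hw.change_start hj).of_iterate (by positivity) (m j)
  rw [← hyx k] at hx
  have hr := (hx.of_iterate (by positivity) (n k)).change_start
    ((dist_comm (f r) _).trans_lt hk)
  rwa [← add_assoc, add_thirds] at hr
end
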